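/- arXiv:2210.09973 — 5 statements merged into one kernel-verified Lean document; each statement's English description precedes it below -/
import Mathlib

section
/- Let H be a group, Δ a finite H-labelled digraph, and v₀, v₁ vertices of Δ. Let K_{v₀} ≤ H be the subgroup generated by the (finitely many) elements π(Lab γ) where γ ranges over the lollipop loops at v₀, and let T = {π(Lab q) : q a simple path in Δ from v₀ to v₁}, a finite subset of H. Then π(L(Δ, v₀, v₁)) = ⋃_{t ∈ T} K_{v₀}·t. In particular, the image in H of the language of Δ from v₀ to v₁ is a finite union of right cosets of a finitely generated subgroup of H. -/
open Pointwise

/-- An `H`-labelled digraph: a finite vertex set, a finite edge set, each edge `e`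
having an initial vertex `o e`, a terminal vertex `t e` and a label `lab e ∈ H`,
together with an involution `e ↦ inv e` with `o (inv e) = t e`, `t (inv e) = o e`
and `lab (inv e) = (lab e)⁻¹`. -/
structure LabelledDigraph (H : Type*) [Group H] where
  V : Type
  E : Type
  [fintypeV : Fintype V]
  [fintypeE : Fintype E]
  o : E → V
  t : E → V
  lab : E → H
  inv : E → E
  inv_inv : ∀ e, inv (inv e) = e
  o_inv : ∀ e, o (inv e) = t e
  t_inv : ∀ e, t (inv e) = o e
  lab_inv : ∀ e, lab (inv e) = (lab e)⁻¹

namespace LabelledDigraph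

attribute [instance] fintypeV fintypeE

variable {H : Type*} [Group H]

/-- `IsPath Δ v₀ v₁ p` : the list of edges `p = e₁ ⋯ e_n` is a path in `Δ` from `v₀`
to `v₁`, i.e. `o e₁ = v₀`, `t e_n = v₁` and `o e_{i+1} = t e_i` (the empty path at a
vertex is a path from that vertex to itself). -/
inductive IsPath (Δ : LabelledDigraph H) : Δ.V → Δ.V → List Δ.E → Prop
  | nil (v : Δ.V) : IsPath Δ v v []
  | cons (e : Δ.E) {v : Δ.V} {p : List Δ.E} :
      IsPath Δ (Δ.t e) v p → IsPath Δ (Δ.o e) v (e :: p)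

/-- `π(Lab p)`, the product in `H` of the labels of the edges of `p`
(the empty path has label `1`). -/
def pathLabel (Δ : LabelledDigraph H) (p : List Δ.E) : H :=
  (p.map Δ.lab).prod

/-- A simple path from `v₀` to `v₁`: a path whose vertex sequence
`v₀, t e₁, …, t e_n` visits no vertex twice. -/
def IsSimplePath (Δ : LabelledDigraph H) (v₀ v₁ : Δ.V) (p : List Δ.E) : Prop :=
  Δ.IsPath v₀ v₁ p ∧ (v₀ :: p.map Δ.t).Nodup

/-- A simple loop at `v`: a nonempty closed path at `v` visiting no vertex twice
except that it begins and ends at `v`. -/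
def IsSimpleLoop (Δ : LabelledDigraph H) (v : Δ.V) (p : List Δ.E) : Prop :=
  p ≠ [] ∧ Δ.IsPath v v p ∧ (p.map Δ.t).Nodup

/-- A lollipop loop at `v`: a path of the form `q ℓ q⁻¹` where `q` is a simple path
from `v` to some vertex `v'` and `ℓ` is a simple loop at `v'`. -/
def IsLollipop (Δ : LabelledDigraph H) (v : Δ.V) (p : List Δ.E) : Prop :=
  ∃ (v' : Δ.V) (q ℓ : List Δ.E), Δ.IsSimplePath v v' q ∧ Δ.IsSimpleLoop v' ℓ ∧
    p = q ++ ℓ ++ (q.reverse.map Δ.inv)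

end LabelledDigraph

namespace LabelledDigraph

variable {H : Type*} [Group H] {Δ : LabelledDigraph H}

@[simp]
theorem pathLabel_nil : Δ.pathLabel [] = 1 := rfl

@[simp]
theorem pathLabel_cons (e : Δ.E) (p : List Δ.E) :
    Δ.pathLabel (e :: p) = Δ.lab e * Δ.pathLabel p := by
  simp [pathLabel]

@[simp]
theorem pathLabel_append (p q : List Δ.E) :
    Δ.pathLabel (p ++ q) = Δ.pathLabel p * Δ.pathLabel q := by
  simp [pathLabel]

theorem pathLabel_reverse_map_inv (p : List Δ.E) :
    Δ.pathLabel (p.reverse.map Δ.inv) = (Δ.pathLabel p)⁻¹ := by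
  induction p with
  | nil => simp
  | cons e p ih => simp_all [Δ.lab_inv]

theorem IsPath.append {u v w : Δ.V} {p q : List Δ.E} (hp : Δ.IsPath u v p)
    (hq : Δ.IsPath v w q) : Δ.IsPath u w (p ++ q) := by
  induction hp with
  | nil => exact hq
  | cons e _ ih => exact .cons e (ih hq)

theorem isPath_singleton (e : Δ.E) : Δ.IsPath (Δ.o e) (Δ.t e) [e] :=
  .cons e (.nil _)

theorem IsPath.reverse {u v : Δ.V} {p : List Δ.E} (hp : Δ.IsPath u v p) :
    Δ.IsPath v u (p.reverse.map Δ.inv) := by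
  induction hp with
  | nil => exact .nil _
  | cons e _ ih =>
    have he := isPath_singleton (Δ := Δ) (Δ.inv e)
    rw [Δ.o_inv, Δ.t_inv] at he
    simpa using ih.append he

/-- A path can be cut at any vertex it visits. -/
theorem IsPath.exists_append {u v w : Δ.V} {p : List Δ.E} (hp : Δ.IsPath u v p)
    (hw : w ∈ u :: p.map Δ.t) :
    ∃ p₁ p₂, p = p₁ ++ p₂ ∧ Δ.IsPath u w p₁ ∧ Δ.IsPath w v p₂ ∧
      w ∈ u :: p₁.map Δ.t := by
  induction hp with
  | nil u =>
    obtain rfl : w = u := by simpa using hw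
    exact ⟨[], [], rfl, .nil _, .nil _, by simp⟩
  | @cons e v p hp ih =>
    rcases List.mem_cons.1 hw with rfl | hw
    · exact ⟨[], e :: p, rfl, .nil _, .cons e hp, by simp⟩
    · obtain ⟨p₁, p₂, rfl, h₁, h₂, h₃⟩ := ih (by simpa using hw)
      exact ⟨e :: p₁, p₂, rfl, .cons e h₁, h₂, List.mem_cons_of_mem _ (by simpa using h₃)⟩

theorem IsLollipop.isPath {v : Δ.V} {p : List Δ.E} (hp : Δ.IsLollipop v p) :
    Δ.IsPath v v p := by
  obtain ⟨v', q, ℓ, hq, hℓ, rfl⟩ := hp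
  exact (hq.1.append hℓ.2.1).append hq.1.reverse

theorem _root_.List.finite_setOf_nodup (α : Type*) [Finite α] : {l : List α | l.Nodup}.Finite := by
  have := Fintype.ofFinite α
  exact (List.finite_length_le α (Fintype.card α)).subset fun _ hl => hl.length_le_card

variable (Δ) in
theorem finite_setOf_isSimplePath (u v : Δ.V) : {p | Δ.IsSimplePath u v p}.Finite := by
  exact (List.finite_setOf_nodup Δ.E).subset
    fun p hp => (List.nodup_cons.1 hp.2).2.of_map _

variable (Δ) in
theorem finite_setOf_isLollipop (v : Δ.V) : {p | Δ.IsLollipop v p}.Finite := by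
  have hfin := List.finite_setOf_nodup Δ.E
  refine (hfin.image2 (fun q ℓ => q ++ ℓ ++ q.reverse.map Δ.inv) hfin).subset ?_
  rintro p ⟨v', q, ℓ, hq, hℓ, rfl⟩
  exact ⟨q, (List.nodup_cons.1 hq.2).2.of_map _, ℓ, hℓ.2.2.of_map _, rfl⟩

variable (Δ) in
/-- The subgroup generated by the labels of the lollipop loops at `v`. -/
def lollipopSubgroup (v : Δ.V) : Subgroup H :=
  Subgroup.closure {h : H | ∃ γ, Δ.IsLollipop v γ ∧ Δ.pathLabel γ = h}

theorem exists_isPath_of_mem_lollipopSubgroup {v : Δ.V} {k : H}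
    (hk : k ∈ Δ.lollipopSubgroup v) : ∃ p, Δ.IsPath v v p ∧ Δ.pathLabel p = k := by
  induction hk using Subgroup.closure_induction with
  | mem x hx =>
    obtain ⟨γ, hγ, rfl⟩ := hx
    exact ⟨γ, hγ.isPath, rfl⟩
  | one => exact ⟨[], .nil _, rfl⟩
  | mul x y _ _ hx hy =>
    obtain ⟨p, hp, rfl⟩ := hx
    obtain ⟨q, hq, rfl⟩ := hy
    exact ⟨p ++ q, hp.append hq, pathLabel_append p q⟩
  | inv x _ hx =>
    obtain ⟨p, hp, rfl⟩ := hx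
    exact ⟨_, hp.reverse, pathLabel_reverse_map_inv p⟩

/-- Extending a simple path by an edge gives, up to a factor in the lollipop subgroup, the label
of a simple path. -/
theorem IsSimplePath.exists_mul_lab {v₀ : Δ.V} {e : Δ.E} {q : List Δ.E}
    (hq : Δ.IsSimplePath v₀ (Δ.o e) q) :
    ∃ k ∈ Δ.lollipopSubgroup v₀, ∃ q', Δ.IsSimplePath v₀ (Δ.t e) q' ∧
      Δ.pathLabel q * Δ.lab e = k * Δ.pathLabel q' := by
  by_cases he : Δ.t e ∈ v₀ :: q.map Δ.t
  · obtain ⟨q₁, q₂, rfl, h₁, h₂, hmem⟩ := hq.1.exists_append he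
    have hnd : ((v₀ :: q₁.map Δ.t) ++ q₂.map Δ.t).Nodup := by simpa using hq.2
    obtain ⟨hnd₁, hnd₂, hdisj⟩ := List.nodup_append'.1 hnd
    have hloop : Δ.IsSimpleLoop (Δ.t e) (q₂ ++ [e]) := by
      refine ⟨by simp, h₂.append (isPath_singleton e), ?_⟩
      rw [List.map_append, List.nodup_append']
      exact ⟨hnd₂, by simp, by simpa using hdisj hmem⟩
    refine ⟨_, Subgroup.subset_closure ⟨_, ⟨Δ.t e, q₁, q₂ ++ [e], ⟨h₁, hnd₁⟩, hloop, rfl⟩, rfl⟩,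
      q₁, ⟨h₁, hnd₁⟩, ?_⟩
    rw [pathLabel_append (q₁ ++ _), pathLabel_reverse_map_inv]
    simp [mul_assoc]
  · refine ⟨1, one_mem _, q ++ [e], ⟨hq.1.append (isPath_singleton e), ?_⟩, by simp⟩
    have : ((v₀ :: q.map Δ.t) ++ [Δ.t e]).Nodup :=
      List.nodup_append'.2 ⟨hq.2, by simp, by simpa using he⟩
    simpa using this

theorem IsPath.exists_isSimplePath_of_append {v₀ u v : Δ.V} {p : List Δ.E}
    (hp : Δ.IsPath u v p) {q : List Δ.E} (hq : Δ.IsSimplePath v₀ u q) :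
    ∃ k ∈ Δ.lollipopSubgroup v₀, ∃ q', Δ.IsSimplePath v₀ v q' ∧
      Δ.pathLabel q * Δ.pathLabel p = k * Δ.pathLabel q' := by
  induction hp generalizing q with
  | nil => exact ⟨1, one_mem _, q, hq, by simp⟩
  | cons e _ ih =>
    obtain ⟨k, hk, q₁, hq₁, h₁⟩ := hq.exists_mul_lab
    obtain ⟨l, hl, q₂, hq₂, h₂⟩ := ih hq₁
    refine ⟨k * l, mul_mem hk hl, q₂, hq₂, ?_⟩
    rw [pathLabel_cons, ← mul_assoc, h₁, mul_assoc, h₂, mul_assoc]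

end LabelledDigraph

/-- Let `H` be a group, `Δ` a finite `H`-labelled digraph, and
`v₀, v₁` vertices of `Δ`. Let `K ≤ H` be the subgroup generated by the (finitely
many) elements `π(Lab γ)` where `γ` ranges over the lollipop loops at `v₀`, and let
`T = {π(Lab q) : q a simple path from v₀ to v₁}`, a finite subset of `H`. Then
`π(L(Δ, v₀, v₁)) = ⋃_{t ∈ T} K·t`. In particular, the image in `H` of the language
of `Δ` from `v₀` to `v₁` is a finite union of right cosets of a finitely generated
subgroup of `H`. -/
theorem stmt_1 {H : Type*} [Group H] (Δ : LabelledDigraph H) (v₀ v₁ : Δ.V)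
    (K : Subgroup H)
    (hK : K = Subgroup.closure {h : H | ∃ γ, Δ.IsLollipop v₀ γ ∧ Δ.pathLabel γ = h})
    (T : Set H)
    (hT : T = {h : H | ∃ q, Δ.IsSimplePath v₀ v₁ q ∧ Δ.pathLabel q = h}) :
    {h : H | ∃ γ, Δ.IsLollipop v₀ γ ∧ Δ.pathLabel γ = h}.Finite ∧
    T.Finite ∧
    {h : H | ∃ p, Δ.IsPath v₀ v₁ p ∧ Δ.pathLabel p = h} =
      ⋃ t ∈ T, (K : Set H) * ({t} : Set H) := by
  subst hK hT
  refine ⟨(Δ.finite_setOf_isLollipop v₀).image Δ.pathLabel,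
    (Δ.finite_setOf_isSimplePath v₀ v₁).image Δ.pathLabel, ?_⟩
  ext h
  simp only [Set.mem_iUnion, Set.mul_singleton, Set.mem_image, exists_prop, Set.mem_ofPred_eq]
  constructor
  · rintro ⟨p, hp, rfl⟩
    obtain ⟨k, hk, q, hq, h⟩ :=
      hp.exists_isSimplePath_of_append (q := []) ⟨.nil v₀, by simp⟩
    exact ⟨_, ⟨q, hq, rfl⟩, k, hk, by simpa using h.symm⟩
  · rintro ⟨_, ⟨q, hq, rfl⟩, k, hk, rfl⟩
    obtain ⟨p, hp, rfl⟩ := LabelledDigraph.exists_isPath_of_mem_lollipopSubgroup hk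
    exact ⟨p ++ q, hp.append hq.1, LabelledDigraph.pathLabel_append p q⟩
end

section
/- With notation as in the context: for all vertices x, y ∈ V(F) and all h ∈ H, the vertices x and h·y lie in the same connected component of the subgraph X = HF if and only if there exist n ≥ 0, elements s₁, …, s_n ∈ H ∖ {1}, and vertices a₁, …, a_n, b₁, …, b_n ∈ V(F) such that, setting b₀ = x and a_{n+1} = y: (i) h = s₁s₂⋯s_n (for n = 0 this means h = 1); (ii) a_i = s_i·b_i in G for each 1 ≤ i ≤ n; and (iii) b_i and a_{i+1} lie in the same connected component of the subgraph F, for each 0 ≤ i ≤ n. -/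
/-- `SameComp Γ W a b` : the vertices `a` and `b` lie in (the vertex set of) the
subgraph `W` of `Γ` and belong to the same connected component of `W`, i.e. there is
a path from `a` to `b` using only vertices and edges of `W`. -/
def SameComp {G : Type*} (Γ : SimpleGraph G) (W : Γ.Subgraph) (a b : G) : Prop :=
  ∃ (ha : a ∈ W.verts) (hb : b ∈ W.verts), W.coe.Reachable ⟨a, ha⟩ ⟨b, hb⟩

theorem sameComp_iff {G : Type*} {Γ : SimpleGraph G} {W : Γ.Subgraph} {a b : G} :
    SameComp Γ W a b ↔ a ∈ W.verts ∧ Relation.ReflTransGen W.Adj a b := by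
  constructor
  · rintro ⟨ha, hb, hab⟩
    rw [SimpleGraph.reachable_iff_reflTransGen] at hab
    exact ⟨ha, hab.lift Subtype.val fun _ _ h => h⟩
  · rintro ⟨ha, hab⟩
    induction hab with
    | refl => exact ⟨ha, ha, SimpleGraph.Reachable.refl _⟩
    | tail _ hbc ih =>
      obtain ⟨_, hb, hr⟩ := ih
      refine ⟨ha, W.edge_vert hbc.symm, hr.trans (SimpleGraph.Adj.reachable ?_)⟩
      exact hbc

/-- `SubgroupChain H F x h y`: the vertices `x` and `h * y` are linked by alternately moving inside
connected components of `F` and splitting off nontrivial elements of `H`, whose product is `h`. -/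
inductive SubgroupChain {G : Type*} [Group G] {Γ : SimpleGraph G} (H : Subgroup G)
    (F : Γ.Subgraph) : G → G → G → Prop
  | base {x y : G} : SameComp Γ F x y → SubgroupChain H F x 1 y
  | cons {x s b h y : G} : SameComp Γ F x (s * b) → s ∈ H → s ≠ 1 → b ∈ F.verts →
      SubgroupChain H F b h y → SubgroupChain H F x (s * h) y

namespace SubgroupChain

variable {G : Type*} [Group G] {Γ : SimpleGraph G} {H : Subgroup G} {F X : Γ.Subgraph}

theorem of_adj {x x' h y : G} (hadj : F.Adj x x') (hc : SubgroupChain H F x' h y) :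
    SubgroupChain H F x h y := by
  have extend {z : G} (hz : SameComp Γ F x' z) : SameComp Γ F x z :=
    sameComp_iff.2 ⟨F.edge_vert hadj, (sameComp_iff.1 hz).2.head hadj⟩
  cases hc with
  | base hxy => exact base (extend hxy)
  | cons hxa hs hs1 hb hc => exact cons (extend hxa) hs hs1 hb hc

theorem mul_left {s b h y : G} (hs : s ∈ H) (hsb : s * b ∈ F.verts) (hb : b ∈ F.verts)
    (hc : SubgroupChain H F b h y) : SubgroupChain H F (s * b) (s * h) y := by
  by_cases hs1 : s = 1
  · simpa [hs1] using hc
  · exact cons (sameComp_iff.2 ⟨hsb, .refl⟩) hs hs1 hb hc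

theorem of_reflTransGen
    (hXe : ∀ a b : G, X.Adj a b ↔ ∃ h ∈ H, F.Adj (h⁻¹ * a) (h⁻¹ * b))
    {p h y : G} (hh : h ∈ H) (hy : y ∈ F.verts)
    (hp : Relation.ReflTransGen X.Adj p (h * y)) {k : G} (hk : k ∈ H)
    (hkp : k⁻¹ * p ∈ F.verts) : SubgroupChain H F (k⁻¹ * p) (k⁻¹ * h) y := by
  induction hp using Relation.ReflTransGen.head_induction_on generalizing k with
  | refl =>
    rw [← mul_assoc] at hkp ⊢
    simpa using mul_left (H.mul_mem (H.inv_mem hk) hh) hkp hy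
      (base (sameComp_iff.2 ⟨hy, .refl⟩) : SubgroupChain H F y 1 y)
  | @head p p' hadj _ ih =>
    obtain ⟨g, hg, hgF⟩ := (hXe p p').1 hadj
    have key := mul_left (s := k⁻¹ * g) (H.mul_mem (H.inv_mem hk) hg)
      (by simpa [mul_assoc] using hkp) (F.edge_vert hgF)
      (of_adj hgF (ih hg (F.edge_vert hgF.symm)))
    simpa [mul_assoc] using key

theorem reflTransGen
    (hXe : ∀ a b : G, X.Adj a b ↔ ∃ h ∈ H, F.Adj (h⁻¹ * a) (h⁻¹ * b))
    {x h y : G} (hc : SubgroupChain H F x h y) : Relation.ReflTransGen X.Adj x (h * y) := by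
  have of_sameComp {a b : G} (hab : SameComp Γ F a b) : Relation.ReflTransGen X.Adj a b :=
    (sameComp_iff.1 hab).2.lift id fun a b h => (hXe a b).2 ⟨1, H.one_mem, by simpa using h⟩
  induction hc with
  | base hxy => simpa using of_sameComp hxy
  | @cons x s b h y hxa hs _ _ _ ih =>
    refine (of_sameComp hxa).trans ?_
    rw [mul_assoc]
    refine ih.lift (s * ·) fun c d hcd => ?_
    obtain ⟨g, hg, hgF⟩ := (hXe c d).1 hcd
    exact (hXe _ _).2 ⟨s * g, H.mul_mem hs hg, by simpa [mul_assoc] using hgF⟩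

theorem exists_tuples {x h y : G} (hc : SubgroupChain H F x h y) :
    ∃ (n : ℕ) (s : Fin n → G) (a b : Fin (n + 1) → G),
      (∀ i : Fin n, s i ∈ H ∧ s i ≠ 1) ∧
      b 0 = x ∧ a (Fin.last n) = y ∧
      (∀ i : Fin n, a i.castSucc ∈ F.verts ∧ b i.succ ∈ F.verts) ∧
      h = (List.ofFn s).prod ∧
      (∀ i : Fin n, a i.castSucc = s i * b i.succ) ∧
      (∀ i : Fin (n + 1), SameComp Γ F (b i) (a i)) := by
  induction hc with
  | @base x y hxy => exact ⟨0, ![], ![y], ![x], by simp [hxy]⟩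
  | @cons x s₀ b₀ h y hxa hs hs1 hb _ ih =>
    obtain ⟨n, s, a, b, hsH, rfl, rfl, hF, rfl, hab, hcomp⟩ := ih
    refine ⟨n + 1, Fin.cons s₀ s, Fin.cons (s₀ * b 0) a, Fin.cons x b, ?_, rfl, ?_, ?_, ?_, ?_, ?_⟩
    · exact Fin.cases ⟨hs, hs1⟩ hsH
    · rw [← Fin.succ_last, Fin.cons_succ]
    · exact Fin.cases ⟨hxa.2.1, hb⟩ hF
    · simp [List.ofFn_succ]
    · exact Fin.cases rfl hab
    · exact Fin.cases hxa hcomp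

theorem of_tuples {n : ℕ} {s : Fin n → G} {a b : Fin (n + 1) → G}
    (hs : ∀ i, s i ∈ H ∧ s i ≠ 1) (hab : ∀ i : Fin n, a i.castSucc = s i * b i.succ)
    (hcomp : ∀ i, SameComp Γ F (b i) (a i)) :
    SubgroupChain H F (b 0) (List.ofFn s).prod (a (Fin.last n)) := by
  induction n with
  | zero => simpa using base (hcomp 0)
  | succ n ih =>
    rw [List.ofFn_succ, List.prod_cons]
    refine cons (b := b 1) ?_ (hs 0).1 (hs 0).2 (hcomp 1).1 ?_
    · exact hab 0 ▸ hcomp 0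
    · exact ih (s := fun i => s i.succ) (a := fun i => a i.succ) (b := fun i => b i.succ)
        (fun i => hs i.succ) (fun i => hab i.succ) fun i => hcomp i.succ

end SubgroupChain

/-- Let `G` be a group with finite symmetric generating set `S`
(`S = S⁻¹`, `1 ∉ S`), `Γ` the corresponding Cayley graph, `H ≤ G` a subgroup, `F` a
finite subgraph of `Γ` and `X = HF` the subgraph whose vertices are `{h·f : h ∈ H,
f ∈ V(F)}` and whose edges are the `H`-translates of the edges of `F`. Then for all
vertices `x, y ∈ V(F)` and all `h ∈ H`, the vertices `x` and `h·y` lie in the same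
connected component of `X` if and only if there exist `n ≥ 0`, elements
`s₁, …, s_n ∈ H ∖ {1}`, and vertices `a₁, …, a_n, b₁, …, b_n ∈ V(F)` such that,
setting `b₀ = x` and `a_{n+1} = y`: (i) `h = s₁s₂⋯s_n`; (ii) `a_i = s_i·b_i` in `G`
for each `1 ≤ i ≤ n`; and (iii) `b_i` and `a_{i+1}` lie in the same connected
component of `F`, for each `0 ≤ i ≤ n`.

(Below, `a i` encodes `a_{i+1}` and `b i` encodes `b_i`, for `i : Fin (n+1)`;
`s i` encodes `s_{i+1}` for `i : Fin n`.) -/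
theorem stmt_3 {G : Type*} [Group G] (S : Set G) (hSfin : S.Finite)
    (hSsymm : ∀ s ∈ S, s⁻¹ ∈ S) (hSone : (1 : G) ∉ S)
    (hSgen : Subgroup.closure S = ⊤)
    (Γ : SimpleGraph G) (hΓ : ∀ g g' : G, Γ.Adj g g' ↔ g⁻¹ * g' ∈ S)
    (H : Subgroup G) (F : Γ.Subgraph) (hF : F.verts.Finite)
    (X : Γ.Subgraph)
    (hXv : X.verts = {g : G | ∃ h ∈ H, ∃ f ∈ F.verts, g = h * f})
    (hXe : ∀ a b : G, X.Adj a b ↔ ∃ h ∈ H, F.Adj (h⁻¹ * a) (h⁻¹ * b))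
    (x y : G) (hx : x ∈ F.verts) (hy : y ∈ F.verts) (h : G) (hh : h ∈ H) :
    SameComp Γ X x (h * y) ↔
      ∃ (n : ℕ) (s : Fin n → G) (a b : Fin (n + 1) → G),
        (∀ i : Fin n, s i ∈ H ∧ s i ≠ 1) ∧
        b 0 = x ∧ a (Fin.last n) = y ∧
        (∀ i : Fin n, a i.castSucc ∈ F.verts ∧ b i.succ ∈ F.verts) ∧
        h = (List.ofFn s).prod ∧
        (∀ i : Fin n, a i.castSucc = s i * b i.succ) ∧
        (∀ i : Fin (n + 1), SameComp Γ F (b i) (a i)) := by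
  constructor
  · intro hxy
    have hc := SubgroupChain.of_reflTransGen hXe hh hy (sameComp_iff.1 hxy).2 H.one_mem
      (by simpa using hx)
    exact SubgroupChain.exists_tuples (by simpa using hc)
  · rintro ⟨n, s, a, b, hs, rfl, rfl, -, rfl, hab, hcomp⟩
    refine sameComp_iff.2 ⟨?_, (SubgroupChain.of_tuples hs hab hcomp).reflTransGen hXe⟩
    rw [hXv]
    exact ⟨1, H.one_mem, b 0, hx, (one_mul _).symm⟩
end

section
/- With notation as in the context: suppose in addition that Y ⊆ H is a finite symmetric generating set of the subgroup H, and let YF denote the subgraph of the Cayley graph with vertex set {y·f : y ∈ Y, f ∈ V(F)} and edge set the Y-translates of the edges of F. If every connected component of X = HF that contains a vertex of YF also contains a vertex of V(F), then every connected component of X contains a vertex of V(F). -/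
theorem SameComp.refl {G : Type*} {Γ : SimpleGraph G} {W : Γ.Subgraph} {a : G}
    (ha : a ∈ W.verts) : SameComp Γ W a a :=
  ⟨ha, ha, SimpleGraph.Reachable.refl _⟩

theorem SameComp.trans {G : Type*} {Γ : SimpleGraph G} {W : Γ.Subgraph} {a b c : G}
    (hab : SameComp Γ W a b) (hbc : SameComp Γ W b c) : SameComp Γ W a c := by
  obtain ⟨ha, _, h₁⟩ := hab
  obtain ⟨_, hc, h₂⟩ := hbc
  exact ⟨ha, hc, h₁.trans h₂⟩

/-- A self-map of the vertices of `Γ` that preserves the vertices and edges of a subgraph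
preserves the relation of lying in the same component. -/
theorem SameComp.map {G : Type*} {Γ : SimpleGraph G} {W : Γ.Subgraph} {a b : G} (φ : G → G)
    (hv : ∀ x ∈ W.verts, φ x ∈ W.verts) (he : ∀ x y, W.Adj x y → W.Adj (φ x) (φ y))
    (hab : SameComp Γ W a b) : SameComp Γ W (φ a) (φ b) := by
  obtain ⟨ha, hb, h⟩ := hab
  let ψ : W.coe →g W.coe := ⟨fun x => ⟨φ x, hv x x.2⟩, fun {x y} hxy => he x y hxy⟩
  exact ⟨hv a ha, hv b hb, h.map ψ⟩

/-- Let `G` be a group with finite symmetric generating set `S`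
(`S = S⁻¹`, `1 ∉ S`), `Γ` the corresponding Cayley graph, `H ≤ G` a subgroup, `F` a
finite subgraph of `Γ` and `X = HF` the subgraph whose vertices are `{h·f : h ∈ H,
f ∈ V(F)}` and whose edges are the `H`-translates of the edges of `F`. Suppose in
addition that `Y ⊆ H` is a finite symmetric generating set of the subgroup `H`.
The vertices of the subgraph `YF` are the elements `y·f` with `y ∈ Y`,
`f ∈ V(F)`. If every connected component of `X` that contains a vertex of `YF`
also contains a vertex of `V(F)`, then every connected component of `X` contains a
vertex of `V(F)`. -/
theorem stmt_8 {G : Type*} [Group G] (S : Set G) (hSfin : S.Finite)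
    (hSsymm : ∀ s ∈ S, s⁻¹ ∈ S) (hSone : (1 : G) ∉ S)
    (hSgen : Subgroup.closure S = ⊤)
    (Γ : SimpleGraph G) (hΓ : ∀ g g' : G, Γ.Adj g g' ↔ g⁻¹ * g' ∈ S)
    (H : Subgroup G) (F : Γ.Subgraph) (hF : F.verts.Finite)
    (X : Γ.Subgraph)
    (hXv : X.verts = {g : G | ∃ h ∈ H, ∃ f ∈ F.verts, g = h * f})
    (hXe : ∀ a b : G, X.Adj a b ↔ ∃ h ∈ H, F.Adj (h⁻¹ * a) (h⁻¹ * b))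
    (Y : Set G) (hYfin : Y.Finite) (hYH : Y ⊆ (H : Set G))
    (hYsymm : ∀ y ∈ Y, y⁻¹ ∈ Y) (hYgen : Subgroup.closure Y = H)
    (hyp : ∀ y ∈ Y, ∀ f ∈ F.verts, ∃ f' ∈ F.verts, SameComp Γ X (y * f) f') :
    ∀ g ∈ X.verts, ∃ f' ∈ F.verts, SameComp Γ X g f' := by
  have translate : ∀ h ∈ H, ∀ a b : G, SameComp Γ X a b → SameComp Γ X (h * a) (h * b) := by
    intro h hh a b
    refine SameComp.map (h * ·) ?_ ?_
    · intro x hx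
      rw [hXv] at hx ⊢
      obtain ⟨k, hk, f, hf, rfl⟩ := hx
      exact ⟨h * k, H.mul_mem hh hk, f, hf, (mul_assoc h k f).symm⟩
    · intro x y hxy
      obtain ⟨k, hk, hadj⟩ := (hXe x y).1 hxy
      exact (hXe _ _).2 ⟨h * k, H.mul_mem hh hk, by simpa [mul_assoc] using hadj⟩
  have step : ∀ y ∈ Y, ∀ k : G, (∀ f ∈ F.verts, ∃ f' ∈ F.verts, SameComp Γ X (k * f) f') →
      ∀ f ∈ F.verts, ∃ f' ∈ F.verts, SameComp Γ X (y * k * f) f' := by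
    intro y hy k hk f hf
    obtain ⟨f₁, hf₁, h₁⟩ := hk f hf
    obtain ⟨f₂, hf₂, h₂⟩ := hyp y hy f₁ hf₁
    refine ⟨f₂, hf₂, ?_⟩
    rw [mul_assoc]
    exact (translate y (hYH hy) _ _ h₁).trans h₂
  have key : ∀ h ∈ Subgroup.closure Y,
      ∀ f ∈ F.verts, ∃ f' ∈ F.verts, SameComp Γ X (h * f) f' := by
    intro h hh
    induction hh using Subgroup.closure_induction_left with
    | one =>
      intro f hf
      rw [one_mul]
      refine ⟨f, hf, SameComp.refl ?_⟩
      rw [hXv]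
      exact ⟨1, H.one_mem, f, hf, (one_mul f).symm⟩
    | mul_left y hy k _ ih => exact step y hy k ih
    | inv_mul_cancel y hy k _ ih => exact step y⁻¹ (hYsymm y hy) k ih
  intro g hg
  rw [hXv] at hg
  obtain ⟨h, hh, f, hf, rfl⟩ := hg
  exact key h (hYgen ▸ hh) f hf
end

section
/- Let G be a group and H ≤ G a subgroup. If X and Y are equivalent nontrivial H-almost invariant subsets of G, then X crosses itself if and only if Y crosses itself. -/
open Pointwise

variable {G : Type*} [Group G]

/-- A subset `A ⊆ G` is `H`-finite if it is contained in a finite union of right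
cosets `Ht₁ ∪ … ∪ Ht_k` (equivalently, its image in `H\G` is finite). -/
def HFin (H : Subgroup G) (A : Set G) : Prop :=
  ∃ T : Finset G, A ⊆ ⋃ t ∈ T, (H : Set G) * ({t} : Set G)

/-- A subset `X ⊆ G` is `H`-almost invariant if `HX = X` and for every `g ∈ G` the
symmetric difference `X △ Xg` is `H`-finite. -/
def HAlmostInvariant (H : Subgroup G) (X : Set G) : Prop :=
  (H : Set G) * X = X ∧ ∀ g : G, HFin H (symmDiff X (X * ({g} : Set G)))

/-- An `H`-almost invariant set `X` is nontrivial if both `X` and its complement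
`G ∖ X` are `H`-infinite. -/
def HNontrivial (H : Subgroup G) (X : Set G) : Prop :=
  ¬ HFin H X ∧ ¬ HFin H Xᶜ

/-- `X` crosses itself: for some `g ∈ G` all four of `gX ∩ X`, `gX ∩ (G∖X)`,
`g(G∖X) ∩ X`, `g(G∖X) ∩ (G∖X)` are `H`-infinite. -/
def CrossesSelf (H : Subgroup G) (X : Set G) : Prop :=
  ∃ g : G,
    ¬ HFin H (({g} : Set G) * X ∩ X) ∧
    ¬ HFin H (({g} : Set G) * X ∩ Xᶜ) ∧
    ¬ HFin H (({g} : Set G) * Xᶜ ∩ X) ∧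
    ¬ HFin H (({g} : Set G) * Xᶜ ∩ Xᶜ)

theorem hFin_iff {H : Subgroup G} {A : Set G} :
    HFin H A ↔ ∃ T : Finset G, ∀ a ∈ A, ∃ t ∈ T, a * t⁻¹ ∈ H := by
  simp only [HFin, Set.subset_def, Set.mem_iUnion, Set.mul_singleton, Set.mem_image,
    SetLike.mem_coe, exists_prop]
  refine exists_congr fun T => forall₂_congr fun a _ => exists_congr fun t => and_congr_right' ?_
  exact ⟨by rintro ⟨h, hh, rfl⟩; simpa using hh, fun h => ⟨_, h, by simp⟩⟩

theorem HFin.mono {H : Subgroup G} {A B : Set G} (hB : HFin H B) (h : A ⊆ B) : HFin H A :=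
  let ⟨T, hT⟩ := hB
  ⟨T, h.trans hT⟩

theorem HFin.biUnion {H : Subgroup G} {ι : Type*} (S : Finset ι) {A : ι → Set G}
    (hA : ∀ i, HFin H (A i)) : HFin H (⋃ i ∈ S, A i) := by
  classical
  choose T hT using hA
  refine ⟨S.biUnion T, Set.iUnion₂_subset fun i hi => (hT i).trans ?_⟩
  exact Set.biUnion_subset_biUnion_left fun t ht => Finset.mem_biUnion.2 ⟨i, hi, ht⟩

theorem HFin.union {H : Subgroup G} {A B : Set G} (hA : HFin H A) (hB : HFin H B) :
    HFin H (A ∪ B) := by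
  have := HFin.biUnion (H := H) Finset.univ (A := fun b : Bool => cond b A B)
    (by rintro (_ | _) <;> assumption)
  exact this.mono (by rintro x (hx | hx) <;> simp [hx])

theorem HAlmostInvariant.mul_mem {H : Subgroup G} {X : Set G} (hX : HAlmostInvariant H X)
    {h x : G} (hh : h ∈ H) (hx : x ∈ X) : h * x ∈ X := by
  rw [← hX.1]
  exact Set.mul_mem_mul hh hx

theorem HAlmostInvariant.compl {H : Subgroup G} {X : Set G} (hX : HAlmostInvariant H X) :
    HAlmostInvariant H Xᶜ := by
  refine ⟨Set.Subset.antisymm ?_ fun x hx => ⟨1, H.one_mem, x, hx, one_mul x⟩, fun g => ?_⟩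
  · rintro _ ⟨h, hh, x, hx, rfl⟩ hmem
    exact hx (by simpa using hX.mul_mem (H.inv_mem hh) hmem)
  · refine (hX.2 g).mono fun x hx => ?_
    simp only [Set.mem_symmDiff, Set.mul_singleton, Set.image_mul_right, Set.mem_preimage,
      Set.mem_compl_iff] at hx ⊢
    tauto

/-- If `gU ∩ V` is `H`-finite, then it is also `gHg⁻¹`-finite. -/
theorem HAlmostInvariant.hFin_inter_conj {H : Subgroup G} {U V : Set G}
    (hU : HAlmostInvariant H U) (hV : HAlmostInvariant H V) (hVinf : ¬ HFin H V) {g : G}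
    (hUV : HFin H {x | g⁻¹ * x ∈ U ∧ x ∈ V}) : HFin H {x | x ∈ U ∧ g * x ∈ V} := by
  obtain ⟨T, hT⟩ := hFin_iff.1 hUV
  obtain ⟨v, hv, hvT⟩ : ∃ v ∈ V, ∀ t ∈ T, v * t⁻¹ ∉ H := by
    by_contra! hcon
    exact hVinf (hFin_iff.2 ⟨T, hcon⟩)
  refine (HFin.biUnion T fun t => hU.2 (t⁻¹ * v)⁻¹).mono ?_
  rintro u ⟨hu, huV⟩
  obtain ⟨t, ht, hh⟩ := hT (g * u) ⟨by simpa using hu, huV⟩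
  refine Set.mem_biUnion ht (Or.inl ⟨hu, fun hmem => ?_⟩)
  simp only [Set.mul_singleton, Set.image_mul_right, Set.mem_preimage, inv_inv] at hmem
  obtain ⟨s, hs, hsH⟩ := hT (g * u * t⁻¹ * v)
    ⟨by simpa [mul_assoc] using hmem, hV.mul_mem hh hv⟩
  refine hvT s hs ?_
  rwa [mul_assoc, H.mul_mem_cancel_left hh] at hsH

/-- `H`-finiteness of a corner `gA ∩ B` depends only on the equivalence classes of `A`, `B`. -/
theorem HFin.corner_of_equiv {H : Subgroup G} {A A' B B' : Set G}
    (hA : HAlmostInvariant H A) (hA' : HAlmostInvariant H A') (hB' : HAlmostInvariant H B')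
    (hA'inf : ¬ HFin H A') (hB'inf : ¬ HFin H B')
    (hAA' : HFin H (symmDiff A A')) (hBB' : HFin H (symmDiff B B')) {g : G}
    (h : HFin H (({g} : Set G) * A ∩ B)) : HFin H (({g} : Set G) * A' ∩ B') := by
  simp only [Set.singleton_mul, Set.image_mul_left] at h ⊢
  have h₁ : HFin H {x | g⁻¹ * x ∈ A ∧ x ∈ B'} := by
    refine (h.union hBB').mono fun x hx => ?_
    simp only [Set.mem_union, Set.mem_inter_iff, Set.mem_preimage, Set.mem_symmDiff,
      Set.mem_ofPred_eq] at hx ⊢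
    tauto
  have h₂ : HFin H {x | g⁻¹⁻¹ * x ∈ B' ∧ x ∈ A'} := by
    refine ((hA.hFin_inter_conj hB' hB'inf h₁).union hAA').mono fun x hx => ?_
    simp only [inv_inv, Set.mem_union, Set.mem_symmDiff, Set.mem_ofPred_eq] at hx ⊢
    tauto
  exact (hB'.hFin_inter_conj hA' hA'inf h₂).mono fun x hx => ⟨hx.2, hx.1⟩

theorem CrossesSelf.of_equiv {H : Subgroup G} {X Y : Set G}
    (hX : HAlmostInvariant H X) (hY : HAlmostInvariant H Y) (hXnt : HNontrivial H X)
    (hXY : HFin H (symmDiff X Y)) (h : CrossesSelf H X) : CrossesSelf H Y := by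
  have hYX : HFin H (symmDiff Y X) := symmDiff_comm X Y ▸ hXY
  have hc : HFin H (symmDiff Yᶜ Xᶜ) := by rwa [compl_symmDiff_compl]
  obtain ⟨g, h₁, h₂, h₃, h₄⟩ := h
  exact ⟨g,
    mt (HFin.corner_of_equiv hY hX hX hXnt.1 hXnt.1 hYX hYX) h₁,
    mt (HFin.corner_of_equiv hY hX hX.compl hXnt.1 hXnt.2 hYX hc) h₂,
    mt (HFin.corner_of_equiv hY.compl hX.compl hX hXnt.2 hXnt.1 hc hYX) h₃,
    mt (HFin.corner_of_equiv hY.compl hX.compl hX.compl hXnt.2 hXnt.2 hc hc) h₄⟩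

/-- Let `G` be a group and `H ≤ G` a subgroup. If `X` and `Y` are
equivalent nontrivial `H`-almost invariant subsets of `G` (i.e. `X △ Y` is
`H`-finite), then `X` crosses itself if and only if `Y` crosses itself. -/
theorem stmt_9 (H : Subgroup G) (X Y : Set G)
    (hX : HAlmostInvariant H X) (hY : HAlmostInvariant H Y)
    (hXnt : HNontrivial H X) (hYnt : HNontrivial H Y)
    (hXY : HFin H (symmDiff X Y)) :
    CrossesSelf H X ↔ CrossesSelf H Y := by
  exact ⟨CrossesSelf.of_equiv hX hY hXnt hXY,
    CrossesSelf.of_equiv hY hX hYnt (symmDiff_comm X Y ▸ hXY)⟩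
end

section
/- Let A be a group with subgroups B, C ≤ A and a group isomorphism φ : B ≅ C. Let G = HNN(A, B, C, φ) be the corresponding HNN extension, with canonical injective homomorphism ι : A → G and stable letter t ∈ G satisfying t·ι(b)·t⁻¹ = ι(φ(b)) for all b ∈ B, and set H = ι(B) ≤ G. Then there exists a nontrivial H-almost invariant subset X ⊆ G that is nested: for every g ∈ G, at least one of the four sets gX ∩ X, gX ∩ (G∖X), g(G∖X) ∩ X, g(G∖X) ∩ (G∖X) is empty. -/
open Pointwise

variable {G : Type*} [Group G]

/-- An `H`-almost invariant set `X ⊆ G` is nested if for every `g ∈ G` at least one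
of the four sets `gX ∩ X`, `gX ∩ (G∖X)`, `g(G∖X) ∩ X`, `g(G∖X) ∩ (G∖X)` is empty. -/
def Nested (X : Set G) : Prop :=
  ∀ g : G,
    ({g} : Set G) * X ∩ X = ∅ ∨ ({g} : Set G) * X ∩ Xᶜ = ∅ ∨
    ({g} : Set G) * Xᶜ ∩ X = ∅ ∨ ({g} : Set G) * Xᶜ ∩ Xᶜ = ∅

section HFinite

variable {H : Subgroup G} {S T : Set G}

theorem hFin_iff_s11 : HFin H S ↔ ∃ F : Finset G, ∀ x ∈ S, ∃ f ∈ F, x * f⁻¹ ∈ H := by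
  simp [HFin, Set.subset_def]

theorem HFin.mono_s11 (hT : HFin H T) (h : S ⊆ T) : HFin H S := by
  obtain ⟨F, hF⟩ := hT
  exact ⟨F, h.trans hF⟩

theorem HFin.union_s11 (hS : HFin H S) (hT : HFin H T) : HFin H (S ∪ T) := by
  classical
  rw [hFin_iff_s11] at *
  obtain ⟨E, hE⟩ := hS
  obtain ⟨F, hF⟩ := hT
  refine ⟨E ∪ F, ?_⟩
  rintro x (hx | hx)
  · obtain ⟨f, hf, h⟩ := hE x hx
    exact ⟨f, Finset.mem_union_left _ hf, h⟩
  · obtain ⟨f, hf, h⟩ := hF x hx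
    exact ⟨f, Finset.mem_union_right _ hf, h⟩

theorem HFin.mul_singleton (hS : HFin H S) (g : G) : HFin H (S * {g}) := by
  classical
  rw [hFin_iff_s11] at *
  obtain ⟨F, hF⟩ := hS
  refine ⟨F.image (· * g), ?_⟩
  intro x hx
  obtain ⟨f, hf, h⟩ := hF _ (by simpa using hx)
  exact ⟨f * g, Finset.mem_image_of_mem _ hf, by simpa [mul_assoc] using h⟩

theorem hFin_empty : HFin H (∅ : Set G) := ⟨∅, by simp⟩

theorem hFin_subgroup : HFin H (H : Set G) := ⟨{1}, by simp⟩

theorem mem_mul_singleton_iff {g x : G} : x ∈ S * {g} ↔ x * g⁻¹ ∈ S := by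
  simp

theorem mem_singleton_mul_iff {g x : G} : x ∈ ({g} : Set G) * S ↔ g⁻¹ * x ∈ S := by
  simp

theorem symmDiff_mul_singleton (S T : Set G) (g : G) :
    symmDiff S T * {g} = symmDiff (S * {g}) (T * {g}) := by
  ext x
  simp only [Set.mem_symmDiff, mem_mul_singleton_iff]

theorem HFin.symmDiff_mul {g k : G} (hg : HFin H (symmDiff S (S * {g})))
    (hk : HFin H (symmDiff S (S * {k}))) : HFin H (symmDiff S (S * {g * k})) := by
  refine (hk.union_s11 (hg.mul_singleton k)).mono_s11 ?_
  rw [symmDiff_mul_singleton, mul_assoc, Set.singleton_mul_singleton]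
  exact symmDiff_triangle _ _ _

theorem HFin.symmDiff_inv {g : G} (hg : HFin H (symmDiff S (S * {g}))) :
    HFin H (symmDiff S (S * {g⁻¹})) := by
  have h := hg.mul_singleton g⁻¹
  rwa [symmDiff_mul_singleton, mul_assoc, Set.singleton_mul_singleton, mul_inv_cancel,
    Set.singleton_one, mul_one, symmDiff_comm] at h

/-- An `H`-finite set takes only finitely many values under a homomorphism that kills `H`. -/
theorem HFin.finite_image {K : Type*} [Group K] (hS : HFin H S) (f : G →* K)
    (hf : H ≤ f.ker) : (f '' S).Finite := by
  rw [hFin_iff_s11] at hS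
  obtain ⟨F, hF⟩ := hS
  refine (F.finite_toSet.image f).subset ?_
  rintro _ ⟨x, hx, rfl⟩
  obtain ⟨y, hy, h⟩ := hF x hx
  refine ⟨y, hy, ?_⟩
  have := hf h
  rw [MonoidHom.mem_ker, map_mul, map_inv, mul_inv_eq_one] at this
  exact this.symm

end HFinite

namespace HNNExtension

variable {A : Type*} [Group A] {B C : Subgroup A} {φ : B ≃* C}

theorem apply_mul_eq_of_generators {α : Type*} {f : HNNExtension A B C φ → α}
    (hof : ∀ x a, f (x * of a) = f x) (ht : ∀ x, f (x * t) = f x)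
    (x y : HNNExtension A B C φ) : f (x * y) = f x := by
  induction y using induction_on generalizing x with
  | of a => exact hof x a
  | t => exact ht x
  | mul y z hy hz => rw [← mul_assoc, hz, hy]
  | inv y hy => rw [← hy (x * y⁻¹), inv_mul_cancel_right]

theorem mul_of_mem_map_iff {x : HNNExtension A B C φ} (b : B) :
    x * of (b : A) ∈ B.map (of : A →* HNNExtension A B C φ) ↔ x ∈ B.map of :=
  Subgroup.mul_mem_cancel_right _ (Subgroup.mem_map_of_mem _ b.2)

variable (B C φ) in
/-- The exponent sum of the stable letter. -/
def exponentSum : HNNExtension A B C φ →* Multiplicative ℤ :=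
  lift 1 (Multiplicative.ofAdd 1) (by simp)

@[simp]
theorem exponentSum_t : exponentSum B C φ t = Multiplicative.ofAdd 1 := lift_t ..

theorem map_of_le_ker_exponentSum : B.map of ≤ (exponentSum B C φ).ker := by
  rintro _ ⟨a, -, rfl⟩
  simp [exponentSum]

theorem t_zpow_mem_map_of_iff {n : ℤ} :
    (t : HNNExtension A B C φ) ^ n ∈ B.map of ↔ n = 0 := by
  refine ⟨fun h => ?_, ?_⟩
  · simpa [MonoidHom.mem_ker, ← ofAdd_zsmul] using map_of_le_ker_exponentSum h
  · rintro rfl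
    simp

variable (B C φ) in
open Classical in
/-- The right translation by `t⁻¹` on the group, twisted by a sign that is switched on the
edge subgroup `of B`. -/
noncomputable def twistedPerm : Equiv.Perm (HNNExtension A B C φ × Bool) where
  toFun p := (p.1 * t⁻¹, p.2 ^^ decide (p.1 ∈ B.map of))
  invFun p := (p.1 * t, p.2 ^^ decide (p.1 * t ∈ B.map of))
  left_inv p := by simp
  right_inv p := by simp

variable (B C φ) in
/-- The right translation action of the base group, with trivial twist. -/
def baseHom : A →* Equiv.Perm (HNNExtension A B C φ × Bool) where
  toFun a := (Equiv.mulRight (of a)⁻¹).prodCongr (Equiv.refl Bool)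
  map_one' := by ext p <;> simp
  map_mul' a b := by ext p <;> simp [mul_assoc]

variable (B C φ) in
/-- The right translation action of the group on itself, twisted by a sign that is switched
when an edge in the orbit of `of B` is crossed. -/
noncomputable def twistedHom :
    HNNExtension A B C φ →* Equiv.Perm (HNNExtension A B C φ × Bool) :=
  lift (baseHom B C φ) (twistedPerm B C φ) <| by
    intro b
    ext1 ⟨x, s⟩
    have h : x * (of (b : A))⁻¹ ∈ B.map of ↔ x ∈ B.map of := by
      simpa using mul_of_mem_map_iff (x := x) b⁻¹
    have e : (of (b : A))⁻¹ * t⁻¹ = t⁻¹ * (of (φ b : A) : HNNExtension A B C φ)⁻¹ := by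
      rw [← mul_inv_rev, ← mul_inv_rev, t_mul_of]
    simp [baseHom, twistedPerm, h, mul_assoc, e]

theorem twistedHom_fst (g x : HNNExtension A B C φ) (s : Bool) :
    (twistedHom B C φ g (x, s)).1 = x * g⁻¹ := by
  induction g using induction_on generalizing x s with
  | of a => simp [twistedHom, baseHom]
  | t => simp [twistedHom, twistedPerm]
  | mul g k hg hk =>
    rw [map_mul, Equiv.Perm.mul_apply, ← Prod.mk.eta (p := twistedHom B C φ k (x, s)), hg, hk,
      mul_inv_rev, mul_assoc]
  | inv g hg =>
    have := hg (twistedHom B C φ g⁻¹ (x, s)).1 (twistedHom B C φ g⁻¹ (x, s)).2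
    rw [Prod.mk.eta, ← Equiv.Perm.mul_apply, ← map_mul, mul_inv_cancel, map_one] at this
    rw [inv_inv, ← mul_inv_eq_iff_eq_mul, ← this]
    rfl

variable (B C φ) in
/-- The elements that move the base vertex of the Bass–Serre tree across the edge stabilized
by `of B`. -/
def halfTree : Set (HNNExtension A B C φ) :=
  {g | (twistedHom B C φ g⁻¹ (1, false)).2 = true}

theorem one_notMem_halfTree : 1 ∉ halfTree B C φ := by
  simp only [halfTree, Set.mem_ofPred_eq, inv_one, map_one, Equiv.Perm.one_apply]
  decide

theorem mul_of_mem_halfTree_iff {x : HNNExtension A B C φ} (a : A) :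
    x * of a ∈ halfTree B C φ ↔ x ∈ halfTree B C φ := by
  have : ∀ p, (twistedHom B C φ (of a)⁻¹ p).2 = p.2 := by
    intro p
    rw [← map_inv]
    simp [twistedHom, baseHom]
  simp only [halfTree, Set.mem_ofPred_eq, mul_inv_rev, map_mul, Equiv.Perm.mul_apply, this]

theorem mul_t_mem_halfTree_iff {x : HNNExtension A B C φ} :
    x * t ∈ halfTree B C φ ↔ ¬ (x ∈ halfTree B C φ ↔ x * t ∈ B.map of) := by
  have : ∀ p, (twistedHom B C φ t⁻¹ p) = (twistedPerm B C φ).symm p := by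
    intro p
    simp [twistedHom, Equiv.Perm.inv_def]
  simp only [halfTree, Set.mem_ofPred_eq, mul_inv_rev, map_mul, Equiv.Perm.mul_apply, this]
  have h := twistedHom_fst (B := B) (φ := φ) x⁻¹ 1 false
  rw [inv_inv, one_mul] at h
  simp only [twistedPerm, Equiv.coe_fn_symm_mk]
  generalize twistedHom B C φ x⁻¹ (1, false) = p at h ⊢
  subst h
  by_cases hp : p.1 * t ∈ B.map of <;> simp [hp, -Subgroup.mem_map]

theorem mem_halfTree_of_mem_map {h : HNNExtension A B C φ} (hh : h ∈ B.map of)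
    (x : HNNExtension A B C φ) : h * x ∈ halfTree B C φ ↔ x ∈ halfTree B C φ := by
  have key := apply_mul_eq_of_generators (φ := φ)
    (f := fun x => (h * x ∈ halfTree B C φ ↔ x ∈ halfTree B C φ))
    (by intro x a; simp only [← mul_assoc, mul_of_mem_halfTree_iff])
    (by
      intro x
      have : h * x * t ∈ B.map of ↔ x * t ∈ B.map of := by
        rw [mul_assoc, Subgroup.mul_mem_cancel_left _ hh]
      simp only [← mul_assoc, mul_t_mem_halfTree_iff, this]
      grind) 1 x
  simp only [one_mul, mul_one] at key
  rw [key]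
  obtain ⟨b, -, rfl⟩ := hh
  simpa using mul_of_mem_halfTree_iff (φ := φ) (x := 1) b

theorem hAlmostInvariant_halfTree : HAlmostInvariant (B.map of) (halfTree B C φ) := by
  refine ⟨?_, fun g => ?_⟩
  · ext x
    constructor
    · rintro ⟨h, hh, y, hy, rfl⟩
      exact (mem_halfTree_of_mem_map hh y).2 hy
    · exact fun hx => ⟨1, one_mem _, x, hx, one_mul x⟩
  · induction g using induction_on with
    | of a =>
      refine hFin_empty.mono_s11 fun x hx => ?_
      rw [Set.mem_symmDiff, mem_mul_singleton_iff, ← map_inv, mul_of_mem_halfTree_iff] at hx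
      tauto
    | t =>
      refine hFin_subgroup.mono_s11 fun x hx => ?_
      have := mul_t_mem_halfTree_iff (φ := φ) (x := x * t⁻¹)
      rw [inv_mul_cancel_right] at this
      rw [Set.mem_symmDiff, mem_mul_singleton_iff] at hx
      rw [SetLike.mem_coe]
      tauto
    | mul g k hg hk => exact hg.symmDiff_mul hk
    | inv g hg => exact hg.symmDiff_inv

theorem t_pow_notMem_halfTree (n : ℕ) : t ^ n ∉ halfTree B C φ := by
  induction n with
  | zero => simpa using one_notMem_halfTree
  | succ n ih =>
    have h : (t : HNNExtension A B C φ) ^ n * t ∉ B.map of := by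
      rw [← pow_succ, ← zpow_natCast, t_zpow_mem_map_of_iff]
      lia
    rw [pow_succ, mul_t_mem_halfTree_iff]
    tauto

theorem inv_t_pow_succ_mem_halfTree (n : ℕ) : (t⁻¹) ^ (n + 1) ∈ halfTree B C φ := by
  have key (m : ℕ) := mul_t_mem_halfTree_iff (φ := φ) (x := t⁻¹ ^ (m + 1))
  simp only [pow_succ (t⁻¹), inv_mul_cancel_right] at key ⊢
  induction n with
  | zero =>
    have := key 0
    have h1 := one_notMem_halfTree (φ := φ)
    have h2 := one_mem (B.map (of : A →* HNNExtension A B C φ))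
    simp only [pow_zero] at this ⊢
    tauto
  | succ n ih =>
    have := key (n + 1)
    have h : (t : HNNExtension A B C φ)⁻¹ ^ (n + 1) ∉ B.map of := by
      rw [inv_pow, ← zpow_natCast, ← zpow_neg, t_zpow_mem_map_of_iff]
      lia
    rw [pow_succ] at this h ⊢
    tauto

theorem hNontrivial_halfTree : HNontrivial (B.map of) (halfTree B C φ) := by
  have aux {S : Set (HNNExtension A B C φ)} (f : ℕ → HNNExtension A B C φ)
      (hf : ∀ n, f n ∈ S) (hinj : Function.Injective (exponentSum B C φ ∘ f)) :
      ¬ HFin (B.map of) S := fun h =>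
    Set.infinite_of_injective_forall_mem hinj
      (fun n => Set.mem_image_of_mem (exponentSum B C φ) (hf n)) (h.finite_image _ map_of_le_ker_exponentSum)
  refine ⟨aux _ inv_t_pow_succ_mem_halfTree fun m n h => ?_,
    aux _ t_pow_notMem_halfTree fun m n h => ?_⟩
  · simpa [← ofAdd_nsmul, ← ofAdd_neg] using h
  · simpa [← ofAdd_nsmul] using h

theorem nested_halfTree : Nested (halfTree B C φ) := by
  intro g
  set X := halfTree B C φ with hX
  set H := B.map (of : A →* HNNExtension A B C φ)
  by_cases hg : g ∈ H
  · right; left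
    ext x
    have := mem_halfTree_of_mem_map (inv_mem hg) x
    simp only [Set.mem_inter_iff, mem_singleton_mul_iff, Set.mem_compl_iff,
      Set.mem_empty_iff_false]
    tauto
  have aux {k x : HNNExtension A B C φ} (hk : k ∉ H) (hx : x * t ∈ H) :
      (k * x ∈ X ↔ k ∈ X) ∧ (k * (x * t) ∈ X ↔ k ∈ X) := by
    have h : k * x * t ∉ H := by rwa [mul_assoc, Subgroup.mul_mem_cancel_right _ hx]
    have h1 : k * (x * t) ∈ X ↔ k ∈ X := by
      obtain ⟨b, -, hb⟩ := hx
      rw [← hb, hX, mul_of_mem_halfTree_iff]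
    have h2 := mul_t_mem_halfTree_iff (φ := φ) (x := k * x)
    rw [mul_assoc] at h h2
    tauto
  have hg' : g⁻¹ ∉ H := by rwa [inv_mem_iff]
  have key := apply_mul_eq_of_generators (φ := φ)
    (f := fun x => ¬ (x ∈ X ↔ g ∈ X) ∧ ¬ (g⁻¹ * x ∈ X ↔ g⁻¹ ∈ X))
    (by intro x a; simp only [← mul_assoc, hX, mul_of_mem_halfTree_iff])
    (by
      intro x
      have h1 := mul_t_mem_halfTree_iff (φ := φ) (x := x)
      have h2 := mul_t_mem_halfTree_iff (φ := φ) (x := g⁻¹ * x)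
      have h3 := aux (x := x) hg'
      have h4 := aux (x := g⁻¹ * x) hg
      simp only [mul_assoc, mul_inv_cancel_left] at h1 h2 h3 h4 ⊢
      grind) 1
  simp only [one_mul, mul_one, iff_self, not_true_eq_false, and_false, eq_iff_iff, iff_false]
    at key
  simp only [Set.eq_empty_iff_forall_notMem, Set.mem_inter_iff, mem_singleton_mul_iff,
    Set.mem_compl_iff]
  by_cases h1 : g ∈ X <;> by_cases h2 : g⁻¹ ∈ X <;> simp only [h1, h2] at key
  · refine .inr (.inr (.inr fun x => ?_)); have := key x; tauto
  · refine .inr (.inl fun x => ?_); have := key x; tauto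
  · refine .inr (.inr (.inl fun x => ?_)); have := key x; tauto
  · refine .inl fun x => ?_; have := key x; tauto

end HNNExtension

/-- Let `A` be a group with subgroups `B, C ≤ A` and a group
isomorphism `φ : B ≅ C`. Let `G = HNN(A, B, C, φ)` be the corresponding HNN
extension (Mathlib's `HNNExtension A B C φ`, whose canonical homomorphism
`HNNExtension.of : A →* HNNExtension A B C φ` is injective and whose stable letter
`t` satisfies `t · of b · t⁻¹ = of (φ b)` for all `b ∈ B`), and set
`H = of(B) ≤ G`. Then there exists a nontrivial `H`-almost invariant subset
`X ⊆ G` that is nested. -/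
theorem stmt_11 {A : Type*} [Group A] (B C : Subgroup A) (φ : B ≃* C) :
    ∃ X : Set (HNNExtension A B C φ),
      HAlmostInvariant
        (B.map (HNNExtension.of : A →* HNNExtension A B C φ)) X ∧
      HNontrivial
        (B.map (HNNExtension.of : A →* HNNExtension A B C φ)) X ∧
      Nested X := by
  exact ⟨HNNExtension.halfTree B C φ, HNNExtension.hAlmostInvariant_halfTree,
    HNNExtension.hNontrivial_halfTree, HNNExtension.nested_halfTree⟩
end
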